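/- Let a, b ∈ ℂ with a + b + 1/2 not a nonpositive integer. Then there is an open neighborhood U of 0 in ℂ such that the function g(x) = (1 - x²)^(-2a) · ₂F₁(a, b; a+b+1/2; -4x²/(x²-1)²) satisfies Heun's differential equation with parameters (t, q; a', b'; c'; d') = (-1, 0; 4a, 2a-2b+1; 2a+2b; 2a-2b+1) at every x ∈ U with x ∉ {0, 1, -1}. -/

import Mathlib

open Complex

/-- `g` satisfies Heun's differential equation with parameters `(t, q; a, b; c; d)`
at the point `x`: `g` is twice complex differentiable at `x` and
`g''(x) + (c/x + d/(x-1) + (a+b-c-d+1)/(x-t)) g'(x) + ((a b x - q)/(x(x-1)(x-t))) g(x) = 0`. -/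
def SatisfiesHeunAt (t q a b c d : ℂ) (g : ℂ → ℂ) (x : ℂ) : Prop :=
  DifferentiableAt ℂ g x ∧ DifferentiableAt ℂ (deriv g) x ∧
    deriv (deriv g) x +
      (c / x + d / (x - 1) + (a + b - c - d + 1) / (x - t)) * deriv g x +
      ((a * b * x - q) / (x * (x - 1) * (x - t))) * g x = 0

lemma hyp_radius (a b c : ℂ) : 1 ≤ (ordinaryHypergeometricSeries ℂ a b c).radius := by
  by_cases h : ∀ kn : ℕ, (kn : ℂ) ≠ -a ∧ (kn : ℂ) ≠ -b ∧ (kn : ℂ) ≠ -c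
  · rw [ordinaryHypergeometricSeries_radius_eq_one ℂ a b c h]
  · have : ∃ k : ℕ, a = -(k : ℂ) ∨ b = -(k : ℂ) ∨ c = -(k : ℂ) := by
      by_contra! h2
      apply h
      intro k
      obtain ⟨h1, h3, h4⟩ := h2 k
      refine ⟨fun e => h1 ?_, fun e => h3 ?_, fun e => h4 ?_⟩ <;> rw [e, neg_neg]
    obtain ⟨k, rfl | rfl | rfl⟩ := this
    · rw [ordinaryHypergeometric_radius_top_of_neg_nat₁]; exact le_top
    · rw [ordinaryHypergeometric_radius_top_of_neg_nat₂]; exact le_top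
    · rw [ordinaryHypergeometric_radius_top_of_neg_nat₃]; exact le_top

lemma hyp_fps (a b c : ℂ) : HasFPowerSeriesOnBall (ordinaryHypergeometric a b c : ℂ → ℂ)
    (ordinaryHypergeometricSeries ℂ a b c) 0 1 := by
  have h := hyp_radius a b c
  exact ((ordinaryHypergeometricSeries ℂ a b c).hasFPowerSeriesOnBall
    (lt_of_lt_of_le one_pos h)).mono one_pos h

lemma hyp_diff (a b c : ℂ) : DifferentiableOn ℂ (ordinaryHypergeometric a b c : ℂ → ℂ)
    (Metric.ball 0 1) := by
  have := (hyp_fps a b c).differentiableOn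
  rwa [← ENNReal.ofReal_one, Metric.eball_ofReal] at this

lemma hyp_iter (a b c : ℂ) (n : ℕ) : iteratedDeriv n (ordinaryHypergeometric a b c : ℂ → ℂ) 0
    = (n.factorial : ℂ) * ordinaryHypergeometricCoefficient a b c n := by
  have := (hyp_fps a b c).factorial_smul 1 n
  rw [iteratedDeriv_eq_iteratedFDeriv, ← this, ordinaryHypergeometricSeries_apply_eq]
  simp

lemma coef_rec (a b c : ℂ) (hc : ∀ n : ℕ, c ≠ -(n : ℂ)) (n : ℕ) :
    ((n : ℂ) + 1) * (c + n) * ordinaryHypergeometricCoefficient a b c (n + 1)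
      = (a + n) * (b + n) * ordinaryHypergeometricCoefficient a b c n := by
  have h1 : c + n ≠ 0 := fun h => hc n (eq_neg_of_add_eq_zero_left h)
  have h2 : (n : ℂ) + 1 ≠ 0 := by exact_mod_cast Nat.succ_ne_zero n
  unfold ordinaryHypergeometricCoefficient
  simp only [ascPochhammer_succ_eval, Nat.factorial_succ, Nat.cast_mul, Nat.cast_add, Nat.cast_one,
    mul_inv]
  field_simp

lemma hyp_ode (a b c : ℂ) (hc : ∀ n : ℕ, c ≠ -(n : ℂ)) (z : ℂ) (hz : z ∈ Metric.ball (0 : ℂ) 1) :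
    z * (1 - z) * deriv (deriv (ordinaryHypergeometric a b c)) z
      + (c - (a + b + 1) * z) * deriv (ordinaryHypergeometric a b c) z
      - a * b * ordinaryHypergeometric a b c z = 0 := by
  set F : ℂ → ℂ := ordinaryHypergeometric a b c with hF
  set u := ordinaryHypergeometricCoefficient a b c with hu
  have d0 : DifferentiableOn ℂ F (Metric.ball 0 1) := hyp_diff a b c
  have d1 : DifferentiableOn ℂ (deriv F) (Metric.ball 0 1) := d0.deriv Metric.isOpen_ball
  have d2 : DifferentiableOn ℂ (deriv (deriv F)) (Metric.ball 0 1) := d1.deriv Metric.isOpen_ball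
  have fne : ∀ n : ℕ, (n.factorial : ℂ) ≠ 0 := fun n => by exact_mod_cast n.factorial_ne_zero
  have nne : ∀ n : ℕ, (n : ℂ) + 1 ≠ 0 := fun n => by exact_mod_cast Nat.succ_ne_zero n
  have s0 : HasSum (fun n : ℕ => u n * z ^ n) (F z) := by
    convert! hasSum_taylorSeries_on_ball d0 hz using 2 with n
    rw [hF, hyp_iter, ← hu, sub_zero, smul_eq_mul, smul_eq_mul]
    field_simp [fne n]
  have s1 : HasSum (fun n : ℕ => ((n : ℂ) + 1) * u (n + 1) * z ^ n) (deriv F z) := by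
    convert! hasSum_taylorSeries_on_ball d1 hz using 2 with n
    rw [← iteratedDeriv_succ', hF, hyp_iter, ← hu, sub_zero, smul_eq_mul, smul_eq_mul,
      Nat.factorial_succ]
    push_cast
    field_simp [fne n]
  have s2 : HasSum (fun n : ℕ => ((n : ℂ) + 2) * (n + 1) * u (n + 2) * z ^ n)
      (deriv (deriv F) z) := by
    convert! hasSum_taylorSeries_on_ball d2 hz using 2 with n
    rw [← iteratedDeriv_succ', ← iteratedDeriv_succ', hF, hyp_iter, ← hu, sub_zero, smul_eq_mul,
      smul_eq_mul, Nat.factorial_succ, Nat.factorial_succ]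
    push_cast
    field_simp [fne n]
    ring
  have t1 : HasSum (fun n : ℕ => (n : ℂ) * u n * z ^ n) (z * deriv F z) := by
    have := (hasSum_nat_add_iff (f := fun n : ℕ => (n : ℂ) * u n * z ^ n) (g := z * deriv F z) 1).1
      (by convert! s1.mul_left z using 2 with n; push_cast; ring)
    simpa using this
  have t2 : HasSum (fun n : ℕ => (n : ℂ) * (n + 1) * u (n + 1) * z ^ n)
      (z * deriv (deriv F) z) := by
    have := (hasSum_nat_add_iff (f := fun n : ℕ => (n : ℂ) * (n + 1) * u (n + 1) * z ^ n)
      (g := z * deriv (deriv F) z) 1).1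
      (by convert! s2.mul_left z using 2 with n; push_cast; ring)
    simpa using this
  have t3 : HasSum (fun n : ℕ => ((n : ℂ) - 1) * n * u n * z ^ n)
      (z * (z * deriv (deriv F) z)) := by
    have := (hasSum_nat_add_iff (f := fun n : ℕ => ((n : ℂ) - 1) * n * u n * z ^ n)
      (g := z * (z * deriv (deriv F) z)) 1).1
      (by convert! t2.mul_left z using 2 with n; push_cast; ring)
    simpa using this
  have tot := (((t2.sub t3).add (s1.mul_left c)).sub (t1.mul_left (a + b + 1))).sub
    (s0.mul_left (a * b))
  have hz0 : HasSum (fun _ : ℕ => (0 : ℂ)) 0 := hasSum_zero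
  have e := tot.unique (by
    convert! hz0 using 2 with n
    have := coef_rec a b c hc n
    rw [← hu] at this
    linear_combination z ^ n * this)
  linear_combination e

theorem stmt15 (a b : ℂ) (hc : ∀ n : ℕ, a + b + 1/2 ≠ -(n : ℂ)) :
    ∃ U : Set ℂ, IsOpen U ∧ (0 : ℂ) ∈ U ∧ ∀ x ∈ U, x ≠ (0 : ℂ) → x ≠ (1 : ℂ) → x ≠ (-1 : ℂ) →
      SatisfiesHeunAt (-1) (0) (4*a) (2*a - 2*b + 1) (2*a + 2*b) (2*a - 2*b + 1)
        (fun x : ℂ => (1 - x^2) ^ (-(2*a)) * ordinaryHypergeometric a b (a + b + 1/2) (-(4*x^2) / (x^2 - 1)^2)) x := by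
  have hode := hyp_ode a b _ hc
  have d0 := hyp_diff a b (a + b + 1/2)
  generalize (ordinaryHypergeometric a b (a + b + 1/2) : ℂ → ℂ) = F at *
  have d1 : DifferentiableOn ℂ (deriv F) (Metric.ball 0 1) := d0.deriv Metric.isOpen_ball
  have ev : ∀ᶠ x : ℂ in nhds 0, 1 - x ^ 2 ∈ slitPlane ∧
      -(4*x^2) / (x^2 - 1)^2 ∈ Metric.ball (0 : ℂ) 1 := by
    apply Filter.Eventually.and
    · have : ContinuousAt (fun x : ℂ => 1 - x ^ 2) 0 := by fun_prop
      exact this.eventually_mem (isOpen_slitPlane.mem_nhds (by simp))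
    · have : ContinuousAt (fun x : ℂ => -(4*x^2) / (x^2 - 1)^2) 0 := by
        apply ContinuousAt.div <;> first | fun_prop | simp
      exact this.eventually_mem (Metric.isOpen_ball.mem_nhds (by simp))
  obtain ⟨U, hU, hUo, h0⟩ := eventually_nhds_iff.1 ev
  refine ⟨U, hUo, h0, fun x hx hx0 hx1 hx2 => ?_⟩
  have hw : ∀ y ∈ U, y ^ 2 - 1 ≠ 0 := fun y hy h => by
    have := slitPlane_ne_zero (hU y hy).1
    apply this
    linear_combination -h
  have hP : ∀ y ∈ U, HasDerivAt (fun x : ℂ => (1 - x^2) ^ (-(2*a)))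
      (-4 * a * y / (y ^ 2 - 1) * (1 - y^2) ^ (-(2*a))) y := fun y hy => by
    have hn := slitPlane_ne_zero (hU y hy).1
    have := (((hasDerivAt_id y).pow 2).const_sub 1).cpow_const (c := -(2*a)) (hU y hy).1
    convert! this using 1
    simp only [Pi.pow_apply, id]
    rw [Complex.cpow_sub _ _ hn, Complex.cpow_one]
    have := hw y hy
    push_cast
    field_simp
    ring
  have hZ : ∀ y ∈ U, HasDerivAt (fun x : ℂ => -(4*x^2) / (x^2 - 1)^2)
      (8 * y * (y ^ 2 + 1) / (y ^ 2 - 1) ^ 3) y := fun y hy => by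
    have := hw y hy
    have h2 := (((hasDerivAt_pow 2 y).const_mul 4).neg).div
      (((hasDerivAt_pow 2 y).sub_const 1).pow 2) (pow_ne_zero 2 this)
    convert! h2 using 1
    simp
    field_simp
    ring
  have hZ2 : ∀ y ∈ U, HasDerivAt (fun y : ℂ => 8 * y * (y ^ 2 + 1) / (y ^ 2 - 1) ^ 3)
      ((24 * y ^ 2 + 8) / (y ^ 2 - 1) ^ 3 - 48 * y ^ 2 * (y ^ 2 + 1) / (y ^ 2 - 1) ^ 4) y :=
    fun y hy => by
    have := hw y hy
    have h2 := (((hasDerivAt_id y).const_mul 8).mul ((hasDerivAt_pow 2 y).add_const 1)).div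
      (((hasDerivAt_pow 2 y).sub_const 1).pow 3) (pow_ne_zero 3 this)
    convert! h2 using 1
    simp
    field_simp
    ring
  have hQ : ∀ y ∈ U, HasDerivAt (fun y : ℂ => -4 * a * y / (y ^ 2 - 1))
      (-4 * a / (y ^ 2 - 1) + 8 * a * y ^ 2 / (y ^ 2 - 1) ^ 2) y :=
    fun y hy => by
    have := hw y hy
    have h2 := ((hasDerivAt_id y).const_mul (-4 * a)).div
      ((hasDerivAt_pow 2 y).sub_const 1) this
    convert! h2 using 1
    simp
    field_simp
    ring
  have hF0 : ∀ y ∈ U, HasDerivAt (fun x : ℂ => F (-(4*x^2) / (x^2 - 1)^2))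
      (deriv F (-(4*y^2) / (y^2 - 1)^2) * (8 * y * (y ^ 2 + 1) / (y ^ 2 - 1) ^ 3)) y :=
    fun y hy => HasDerivAt.comp (h₂ := F) y
      (d0.differentiableAt (Metric.isOpen_ball.mem_nhds (hU y hy).2)).hasDerivAt (hZ y hy)
  have hF1 : ∀ y ∈ U, HasDerivAt (fun x : ℂ => deriv F (-(4*x^2) / (x^2 - 1)^2))
      (deriv (deriv F) (-(4*y^2) / (y^2 - 1)^2) * (8 * y * (y ^ 2 + 1) / (y ^ 2 - 1) ^ 3)) y :=
    fun y hy => HasDerivAt.comp (h₂ := deriv F) y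
      (d1.differentiableAt (Metric.isOpen_ball.mem_nhds (hU y hy).2)).hasDerivAt (hZ y hy)
  have hg : ∀ y ∈ U, HasDerivAt
      (fun x : ℂ => (1 - x^2) ^ (-(2*a)) * F (-(4*x^2) / (x^2 - 1)^2)) _ y :=
    fun y hy => (hP y hy).mul (hF0 y hy)
  have hder : deriv (fun x : ℂ => (1 - x^2) ^ (-(2*a)) * F (-(4*x^2) / (x^2 - 1)^2)) =ᶠ[nhds x]
      _ := Filter.eventuallyEq_of_mem (hUo.mem_nhds hx) (fun y hy => (hg y hy).deriv)
  have hg2 := ((((hQ x hx).mul (hP x hx)).mul (hF0 x hx)).add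
    ((hP x hx).mul ((hF1 x hx).mul (hZ2 x hx)))).congr_of_eventuallyEq hder
  refine ⟨(hg x hx).differentiableAt, hg2.differentiableAt, ?_⟩
  rw [hg2.deriv, (hg x hx).deriv]
  have ho := hode _ (hU x hx).2
  have h1 := hw x hx
  have h3 : x - 1 ≠ 0 := sub_ne_zero.2 hx1
  have h4 : x - -1 ≠ 0 := sub_ne_zero.2 hx2
  simp only [Pi.mul_apply]
  generalize deriv (deriv F) (-(4*x^2) / (x^2 - 1)^2) = f2 at *
  generalize deriv F (-(4*x^2) / (x^2 - 1)^2) = f1 at *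
  generalize F (-(4*x^2) / (x^2 - 1)^2) = f0 at *
  generalize (1 - x^2) ^ (-(2*a)) = P at *
  have e1 : (2*a + 2*b) / x + (2*a - 2*b + 1) / (x - 1)
      + (4*a + (2*a - 2*b + 1) - (2*a + 2*b) - (2*a - 2*b + 1) + 1) / (x - -1)
      = (2*a + 2*b) / x + (2*a - 2*b + 1) * (2 * x) / (x ^ 2 - 1) := by
    field_simp
    ring
  have e2 : (4*a*(2*a - 2*b + 1)*x - 0) / (x * (x - 1) * (x - -1))
      = 4*a*(2*a - 2*b + 1) / (x ^ 2 - 1) := by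
    field_simp
    ring
  rw [e1, e2]
  clear e1 e2 h3 h4
  linear_combination (norm := skip) (-16 / (x ^ 2 - 1) ^ 2 * P) * ho
  clear hg2
  field_simp
  ring
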